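/- arXiv:1611.05256 — 3 statements merged into one kernel-verified Lean document; each statement's English description precedes it below -/
import Mathlib

section
/- For all integers n, k with 0 ≤ k ≤ n, the sum ∑_{j=0}^{min(k, n−k)} (−1)^j q^{j(j+1)/2} [k choose j]_q [n−j choose k]_q equals 1. -/
open Finset

/-- The indeterminate `q`, viewed in the field `ℚ(q)` of rational functions. -/
noncomputable def q : RatFunc ℚ := RatFunc.X

/-- The Gaussian binomial coefficient `[n choose k]_q` in `ℚ(q)`, defined for integer
arguments: it is `∏_{i=1}^k (1 - q^{n-k+i})/(1 - q^i)` if `0 ≤ k ≤ n`, and `0` if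
`k < 0` or `k > n` (with the convention `[m choose 0]_q = 1` for every integer `m`). -/
noncomputable def qbinom (n k : ℤ) : RatFunc ℚ :=
  if 0 ≤ k ∧ k ≤ n then
    ∏ i ∈ Finset.range k.toNat, (1 - q ^ (n - k + (i : ℤ) + 1)) / (1 - q ^ ((i : ℤ) + 1))
  else if k = 0 then 1 else 0

/-- The finite `q`-Pochhammer product `(q; q)_n = ∏_{i=1}^n (1 - q^i)`. -/
noncomputable def qPochhammer (n : ℕ) : RatFunc ℚ := ∏ i ∈ range n, (1 - q ^ (i + 1))

lemma one_sub_q_pow_ne_zero (i : ℕ) : 1 - q ^ (i + 1) ≠ 0 := by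
  intro h
  have h' : algebraMap (Polynomial ℚ) (RatFunc ℚ) (1 - Polynomial.X ^ (i + 1)) =
      algebraMap (Polynomial ℚ) (RatFunc ℚ) 0 := by
    simpa [q] using h
  have h0 := congrArg (Polynomial.eval 0) (RatFunc.algebraMap_injective ℚ h')
  simp at h0

lemma qPochhammer_ne_zero (n : ℕ) : qPochhammer n ≠ 0 :=
  prod_ne_zero_iff.2 fun i _ => one_sub_q_pow_ne_zero i

lemma qPochhammer_succ (n : ℕ) : qPochhammer (n + 1) = qPochhammer n * (1 - q ^ (n + 1)) :=
  prod_range_succ _ _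

lemma qbinom_add_right (a k : ℕ) :
    qbinom (a + k : ℕ) k = qPochhammer (a + k) / (qPochhammer a * qPochhammer k) := by
  have hprod : qPochhammer (a + k) = qPochhammer a * ∏ i ∈ range k, (1 - q ^ (a + i + 1)) :=
    prod_range_add _ _ _
  rw [hprod, mul_div_mul_left _ _ (qPochhammer_ne_zero a), qPochhammer, ← prod_div_distrib,
    qbinom, if_pos (by simp)]
  refine prod_congr rfl fun i _ => ?_
  have h : ((a + k : ℕ) : ℤ) - k + i + 1 = ((a + i + 1 : ℕ) : ℤ) := by push_cast; ring
  have h' : (i : ℤ) + 1 = ((i + 1 : ℕ) : ℤ) := by push_cast; ring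
  rw [h, h', zpow_natCast, zpow_natCast]

lemma qbinom_zero_right (n : ℤ) : qbinom n 0 = 1 := by simp [qbinom]

lemma qbinom_self (n : ℕ) : qbinom n n = 1 := by
  have h := qbinom_add_right 0 n
  rw [zero_add] at h
  have h0 : qPochhammer 0 = 1 := prod_range_zero _
  rw [h, h0, one_mul, div_self (qPochhammer_ne_zero n)]

lemma qbinom_eq_zero_of_lt {n k : ℕ} (h : n < k) : qbinom n k = 0 := by
  rw [qbinom, if_neg (by omega), if_neg (by omega)]

/-- The `q`-Pascal rule with the power of `q` on the term with lower index `k + 1`. -/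
lemma qbinom_succ_succ (a k : ℕ) :
    qbinom (a + 1 + (k + 1) : ℕ) (k + 1 : ℕ) =
      qbinom (a + 1 + k : ℕ) k + q ^ (k + 1) * qbinom (a + (k + 1) : ℕ) (k + 1 : ℕ) := by
  have e : a + 1 + k = a + (k + 1) := by ring
  have e' : a + 1 + (k + 1) = a + (k + 1) + 1 := by ring
  simp only [qbinom_add_right]
  rw [e', e, qPochhammer_succ (a + (k + 1)), qPochhammer_succ a, qPochhammer_succ k]
  have := qPochhammer_ne_zero a
  have := qPochhammer_ne_zero k
  have := one_sub_q_pow_ne_zero a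
  have := one_sub_q_pow_ne_zero k
  field_simp
  ring

/-- The `q`-Pascal rule with the power of `q` on the term with lower index `j`, multiplied by
`q ^ (j + 1)` so that it holds for all `j`. -/
lemma q_pow_mul_qbinom_succ_succ (k j : ℕ) :
    q ^ (j + 1) * qbinom (k + 1 : ℕ) (j + 1 : ℕ) =
      q ^ (j + 1) * qbinom k (j + 1 : ℕ) + q ^ (k + 1) * qbinom k j := by
  rcases lt_trichotomy k j with h | rfl | h
  · rw [qbinom_eq_zero_of_lt h, qbinom_eq_zero_of_lt (show k < j + 1 by omega),
      qbinom_eq_zero_of_lt (show k + 1 < j + 1 by omega)]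
    ring
  · rw [qbinom_self, qbinom_self, qbinom_eq_zero_of_lt (Nat.lt_succ_self k)]
    ring
  · obtain ⟨a, rfl⟩ : ∃ a, k = a + (j + 1) := ⟨k - (j + 1), by omega⟩
    have e : a + (j + 1) = a + 1 + j := by ring
    have e' : a + (j + 1) + 1 = a + 1 + (j + 1) := by ring
    have h₁ := qbinom_add_right (a + 1) j
    rw [← e] at h₁
    rw [h₁, qbinom_add_right, e', qbinom_add_right, ← e', qPochhammer_succ (a + (j + 1)),
      qPochhammer_succ a, qPochhammer_succ j]
    have := qPochhammer_ne_zero a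
    have := qPochhammer_ne_zero j
    have := one_sub_q_pow_ne_zero a
    have := one_sub_q_pow_ne_zero j
    field_simp
    ring

/-- The series `∑_j (-1)^j q^{j(j+1)/2} [k choose j]_q z^j = ∏_{i=1}^k (1 - q^i z)`. -/
noncomputable def qbinomRowSeries (k : ℕ) : PowerSeries (RatFunc ℚ) :=
  .mk fun j => (-1) ^ j * q ^ (j * (j + 1) / 2) * qbinom k j

/-- The series `∑_m [m + k choose k]_q z^m = ∏_{i=0}^k (1 - q^i z)⁻¹`. -/
noncomputable def qbinomColumnSeries (k : ℕ) : PowerSeries (RatFunc ℚ) :=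
  .mk fun m => qbinom (m + k : ℕ) k

lemma qbinomRowSeries_succ (k : ℕ) :
    qbinomRowSeries (k + 1) =
      qbinomRowSeries k * (1 - PowerSeries.C (q ^ (k + 1)) * PowerSeries.X) := by
  rw [mul_sub, mul_one, mul_left_comm]
  ext j
  rcases j with _ | j
  · simp [qbinomRowSeries, qbinom_zero_right]
  · have e : (j + 1) * (j + 1 + 1) / 2 = j * (j + 1) / 2 + (j + 1) := by
      rw [show (j + 1) * (j + 1 + 1) = j * (j + 1) + (j + 1) * 2 by ring,
        Nat.add_mul_div_right _ _ two_pos]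
    rw [map_sub, PowerSeries.coeff_C_mul, PowerSeries.coeff_succ_mul_X]
    simp only [qbinomRowSeries, PowerSeries.coeff_mk]
    rw [e]
    linear_combination (-1) ^ (j + 1) * q ^ (j * (j + 1) / 2) * q_pow_mul_qbinom_succ_succ k j

lemma qbinomColumnSeries_succ (k : ℕ) :
    (1 - PowerSeries.C (q ^ (k + 1)) * PowerSeries.X) * qbinomColumnSeries (k + 1) =
      qbinomColumnSeries k := by
  rw [sub_mul, one_mul, mul_assoc]
  ext m
  rw [map_sub, PowerSeries.coeff_C_mul]
  rcases m with _ | m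
  · simp only [qbinomColumnSeries, PowerSeries.coeff_zero_X_mul, PowerSeries.coeff_mk, zero_add,
      qbinom_self, mul_zero, sub_zero]
  · rw [PowerSeries.coeff_succ_X_mul]
    simp only [qbinomColumnSeries, PowerSeries.coeff_mk]
    linear_combination qbinom_succ_succ m k

lemma qbinomRowSeries_mul_qbinomColumnSeries (k : ℕ) :
    qbinomRowSeries k * qbinomColumnSeries k = .mk 1 := by
  induction k with
  | zero =>
    have h : qbinomRowSeries 0 = 1 := by
      ext j
      rcases j with _ | j
      · simp [qbinomRowSeries, qbinom_zero_right]
      · simp only [qbinomRowSeries, PowerSeries.coeff_mk, PowerSeries.coeff_one,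
          qbinom_eq_zero_of_lt (Nat.succ_pos j), mul_zero, Nat.succ_ne_zero, if_false]
    rw [h, one_mul]
    ext m
    simp [qbinomColumnSeries, qbinom_zero_right]
  | succ k ih => rw [qbinomRowSeries_succ, mul_assoc, qbinomColumnSeries_succ, ih]

theorem carlitz_sum_eq_one (n k : ℤ) (hk : 0 ≤ k) (hkn : k ≤ n) :
    ∑ j ∈ Finset.range ((min k (n - k)).toNat + 1),
      (-1 : RatFunc ℚ) ^ j * q ^ (j * (j + 1) / 2) * qbinom k j * qbinom (n - j) k = 1 := by
  lift k to ℕ using hk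
  obtain ⟨m, rfl⟩ : ∃ m : ℕ, n = m + k := ⟨(n - k).toNat, by omega⟩
  have h := congrArg (PowerSeries.coeff m) (qbinomRowSeries_mul_qbinomColumnSeries k)
  rw [PowerSeries.coeff_mul, Nat.sum_antidiagonal_eq_sum_range_succ_mk] at h
  simp only [qbinomRowSeries, qbinomColumnSeries, PowerSeries.coeff_mk, Pi.one_apply] at h
  refine Eq.trans ?_ h
  rw [show (min (k : ℤ) (m + k - k)).toNat = min k m by omega]
  have hsub : range (min k m + 1) ⊆ range (m + 1) := range_subset_range.2 (by omega)
  rw [Nat.succ_eq_add_one, ← sum_subset hsub]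
  · refine sum_congr rfl fun j hj => ?_
    rw [mem_range] at hj
    rw [show ((m - j + k : ℕ) : ℤ) = m + k - j by omega]
  · intro j hj hj'
    rw [mem_range] at hj hj'
    rw [qbinom_eq_zero_of_lt (show k < j by omega), mul_zero, zero_mul]
end

section
/- For every integer n ≥ 2, L_n(x,q) = F_n(x,q) − q^{n−1} F_{n−2}(x,q) in ℚ(q)[x]. -/
open Finset Polynomial

/-- `[n] = (1 - q^n)/(1 - q)` in `ℚ(q)`. -/
noncomputable def qint (n : ℕ) : RatFunc ℚ := (1 - q ^ n) / (1 - q)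

/-- The q-Fibonacci polynomial. -/
noncomputable def qFib (n : ℕ) : Polynomial (RatFunc ℚ) :=
  ∑ j ∈ Finset.range (n / 2 + 1),
    Polynomial.C ((-1 : RatFunc ℚ) ^ j * q ^ (j * (j - 1) / 2) * qbinom ((n : ℤ) - j) j) *
      Polynomial.X ^ (n - 2 * j)

/-- The q-Lucas polynomial. -/
noncomputable def qLucas (n : ℕ) : Polynomial (RatFunc ℚ) :=
  if n = 0 then 1
  else ∑ k ∈ Finset.range (n / 2 + 1),
    Polynomial.C ((-1 : RatFunc ℚ) ^ k * q ^ (k * (k - 1) / 2) * (qint n / qint (n - k)) *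
        qbinom ((n : ℤ) - k) k) *
      Polynomial.X ^ (n - 2 * k)

theorem one_sub_q_pow_ne_zero_s5 {n : ℕ} (hn : n ≠ 0) : (1 - q ^ n : RatFunc ℚ) ≠ 0 := by
  have h : (1 - q ^ n : RatFunc ℚ) =
      algebraMap (Polynomial ℚ) (RatFunc ℚ) (1 - Polynomial.X ^ n) := by
    simp [q, RatFunc.algebraMap_X]
  rw [h]
  refine RatFunc.algebraMap_ne_zero fun h0 => ?_
  have := congrArg (Polynomial.eval 0) h0
  simp [hn] at this

theorem one_sub_q_ne_zero : (1 - q : RatFunc ℚ) ≠ 0 := by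
  simpa using one_sub_q_pow_ne_zero_s5 one_ne_zero

theorem qbinom_add_self (m k : ℕ) :
    qbinom ((m : ℤ) + k) k =
      ∏ i ∈ Finset.range k, (1 - q ^ (m + i + 1)) / (1 - q ^ (i + 1)) := by
  rw [qbinom, if_pos ⟨by omega, by omega⟩, Int.toNat_natCast]
  refine Finset.prod_congr rfl fun i _ => ?_
  rw [show (m : ℤ) + k - k + i + 1 = ((m + i + 1 : ℕ) : ℤ) by push_cast; ring,
    show (i : ℤ) + 1 = ((i + 1 : ℕ) : ℤ) by push_cast; ring, zpow_natCast, zpow_natCast]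

theorem qbinom_add_succ (m k : ℕ) :
    qbinom ((m : ℤ) + (k + 1 : ℕ)) (k + 1 : ℕ) =
      qbinom ((m : ℤ) + k) k * ((1 - q ^ (m + k + 1)) / (1 - q ^ (k + 1))) := by
  rw [qbinom_add_self, qbinom_add_self, Finset.prod_range_succ]

/-- `[m + 2k + 2] / [m + k + 1] * [m + k + 1 choose k + 1]` splits as a sum of two Gaussian
binomial coefficients. -/
theorem qint_div_mul_qbinom (m k : ℕ) :
    qint (m + 2 * k + 2) / qint (m + k + 1) * qbinom ((m : ℤ) + (k + 1 : ℕ)) (k + 1 : ℕ) =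
      qbinom ((m : ℤ) + (k + 1 : ℕ)) (k + 1 : ℕ) +
        q ^ (m + k + 1) * qbinom ((m : ℤ) + k) k := by
  have h2 := one_sub_q_pow_ne_zero_s5 (Nat.succ_ne_zero k)
  have h3 := one_sub_q_pow_ne_zero_s5 (Nat.succ_ne_zero (m + k))
  rw [Nat.succ_eq_add_one] at h2 h3
  rw [qbinom_add_succ, qint, qint, div_div_div_cancel_right₀ one_sub_q_ne_zero]
  field_simp
  ring

/-- `L_n(x,q) = F_n(x,q) − q^{n−1} F_{n−2}(x,q)` for `n ≥ 2`. -/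
theorem qLucas_eq_qFib_sub (n : ℕ) (hn : 2 ≤ n) :
    qLucas n = qFib n - Polynomial.C (q ^ (n - 1)) * qFib (n - 2) := by
  have hr : (n - 2) / 2 + 1 = n / 2 := by omega
  have hq : qint n ≠ 0 :=
    div_ne_zero (one_sub_q_pow_ne_zero_s5 (by omega)) one_sub_q_ne_zero
  rw [qLucas, if_neg (by omega), qFib, qFib, hr, Finset.sum_range_succ',
    Finset.sum_range_succ' _ (n / 2), Finset.mul_sum, add_sub_right_comm,
    ← Finset.sum_sub_distrib]
  congr 1
  · refine Finset.sum_congr rfl fun k hk => ?_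
    rw [Finset.mem_range] at hk
    obtain ⟨m, rfl⟩ : ∃ m, n = m + 2 * k + 2 := ⟨n - 2 * k - 2, by omega⟩
    have e1 : ((m + 2 * k + 2 : ℕ) : ℤ) - (k + 1 : ℕ) = (m : ℤ) + (k + 1 : ℕ) := by
      push_cast; ring
    have e2 : ((m + 2 * k + 2 - 2 : ℕ) : ℤ) - k = (m : ℤ) + k := by
      rw [Nat.add_sub_cancel]; push_cast; ring
    have e3 : m + 2 * k + 2 - (k + 1) = m + k + 1 := by omega
    have e4 : m + 2 * k + 2 - 2 * (k + 1) = m := by omega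
    have e5 : m + 2 * k + 2 - 2 - 2 * k = m := by omega
    have e6 : m + 2 * k + 2 - 1 = (m + k + 1) + k := by omega
    have e7 : (k + 1) * (k + 1 - 1) / 2 = k + k * (k - 1) / 2 := by
      rw [← Finset.sum_range_id_mul_two, ← Finset.sum_range_id_mul_two,
        Nat.mul_div_cancel _ two_pos, Nat.mul_div_cancel _ two_pos, Finset.sum_range_succ,
        add_comm]
    rw [e1, e2, e3, e4, e5, e6, e7, mul_assoc (_ * _) (_ / _), qint_div_mul_qbinom, ← mul_assoc,
      ← Polynomial.C_mul, ← sub_mul, ← Polynomial.C_sub]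
    congr 2
    ring
  · simp [div_self hq]
end

section
/- The coefficients b(n,k,t,q) satisfy, for all n ≥ 1 and k ≥ 0: b(2n,2k,t,q) = b(2n−1,2k−1,qt,q) + τ_{2k}(t,q) b(2n−1,2k+1,qt,q) and b(2n+1,2k+1,t,q) = b(2n,2k,qt,q) + τ_{2k+1}(t,q) b(2n,2k+2,qt,q), where b(m,j,qt,q) denotes the result of substituting qt for t, and where τ_0(t,q) = 1 + qt, τ_{2m}(t,q) = q^m (1 + q^{m+1} t^{m+1})/(1 + q^m t^m) for m ≥ 1, and τ_{2m+1}(t,q) = q^{m+1} t (1 + t^m)/(1 + t^{m+1}). -/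
open Finset

/-- The field `ℚ(q,t)` of rational functions in two independent indeterminates,
realized as `ℚ(q)(t)`. -/
noncomputable abbrev F2 : Type := RatFunc (RatFunc ℚ)

/-- The indeterminate `q`, viewed in `ℚ(q,t)`. -/
noncomputable def qq : F2 := RatFunc.C RatFunc.X

/-- The indeterminate `t`, viewed in `ℚ(q,t)`. -/
noncomputable def tt : F2 := RatFunc.X

/-- The Gaussian binomial coefficient `[n choose k]_q`, viewed in `ℚ(q,t)`. -/
noncomputable def qbinomF (n k : ℤ) : F2 :=
  if 0 ≤ k ∧ k ≤ n then
    ∏ i ∈ Finset.range k.toNat, (1 - qq ^ (n - k + (i : ℤ) + 1)) / (1 - qq ^ ((i : ℤ) + 1))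
  else if k = 0 then 1 else 0

/-- `τ_0(t,q) = 1 + qt`, `τ_{2m}(t,q) = q^m (1 + q^{m+1} t^{m+1})/(1 + q^m t^m)` for
`m ≥ 1`, and `τ_{2m+1}(t,q) = q^{m+1} t (1 + t^m)/(1 + t^{m+1})`, as a function of an
arbitrary value substituted for `t`. -/
noncomputable def tauB (m : ℤ) (t : F2) : F2 :=
  if m = 0 then 1 + qq * t
  else if m % 2 = 0 then
    qq ^ (m / 2) * (1 + qq ^ (m / 2 + 1) * t ^ (m / 2 + 1)) / (1 + qq ^ (m / 2) * t ^ (m / 2))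
  else qq ^ ((m - 1) / 2 + 1) * t * (1 + t ^ ((m - 1) / 2)) / (1 + t ^ ((m - 1) / 2 + 1))

/-- The connection coefficients `b(m, j, t, q) ∈ ℚ(q,t)`, as functions of the value
substituted for `t`:
`b(2n,2k,t,q) = ∑_{i=0}^{n−k} q^{i(i+k)} [n choose i][n choose i+k] t^i`,
`b(2n+1,2k+1,t,q) = (1/(1+t^{k+1})) ∑_{i=0}^{n−k} [n choose k+i][n+1 choose i]
  (q^{i(i+k)} t^i + q^{(n+1−i)(n−i−k)} t^{n+1−i})`,
and `b(m,j,t,q) = 0` whenever `m − j` is odd or `j < 0` or `j > m`. -/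
noncomputable def coeffBB (m j : ℤ) (t : F2) : F2 :=
  if 0 ≤ j ∧ j ≤ m ∧ (m - j) % 2 = 0 then
    if m % 2 = 0 then
      ∑ i ∈ Finset.range ((m / 2 - j / 2).toNat + 1),
        qq ^ ((i : ℤ) * ((i : ℤ) + j / 2)) * qbinomF (m / 2) i *
          qbinomF (m / 2) ((i : ℤ) + j / 2) * t ^ (i : ℕ)
    else
      (1 + t ^ (j / 2 + 1))⁻¹ *
        ∑ i ∈ Finset.range ((m / 2 - j / 2).toNat + 1),
          qbinomF (m / 2) (j / 2 + (i : ℤ)) * qbinomF (m / 2 + 1) i *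
            (qq ^ ((i : ℤ) * ((i : ℤ) + j / 2)) * t ^ (i : ℕ) +
             qq ^ ((m / 2 + 1 - (i : ℤ)) * (m / 2 - (i : ℤ) - j / 2)) * t ^ (m / 2 + 1 - (i : ℤ)))
  else 0

/-! ### Nonvanishing in `ℚ(q,t)` -/

lemma one_sub_qq_pow_ne_zero (i : ℕ) : (1 : F2) - qq ^ (i + 1) ≠ 0 := by
  have h : (1 : Polynomial ℚ) - Polynomial.X ^ (i + 1) ≠ 0 := fun h => by
    simpa using congrArg (Polynomial.eval 0) h
  have h' : (1 : RatFunc ℚ) - RatFunc.X ^ (i + 1) ≠ 0 := fun e => h <| by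
    apply RatFunc.algebraMap_injective ℚ
    simpa using e
  intro e
  apply h'
  apply (RatFunc.C (K := RatFunc ℚ)).injective
  simpa [qq] using e

lemma one_add_C_mul_tt_pow_ne_zero (a : RatFunc ℚ) (i : ℕ) :
    (1 : F2) + RatFunc.C a * tt ^ (i + 1) ≠ 0 := by
  have h : (1 : Polynomial (RatFunc ℚ)) + Polynomial.C a * Polynomial.X ^ (i + 1) ≠ 0 :=
    fun h => by simpa using congrArg (Polynomial.eval 0) h
  exact fun e => h <| by
    apply RatFunc.algebraMap_injective (RatFunc ℚ)
    simpa [tt] using e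

lemma one_add_tt_pow_ne_zero (i : ℕ) : (1 : F2) + tt ^ (i + 1) ≠ 0 := by
  simpa using one_add_C_mul_tt_pow_ne_zero 1 i

lemma one_add_qq_mul_tt_pow_ne_zero (i : ℕ) : (1 : F2) + (qq * tt) ^ (i + 1) ≠ 0 := by
  have h := one_add_C_mul_tt_pow_ne_zero (RatFunc.X ^ (i + 1)) i
  rwa [map_pow, ← mul_pow] at h

/-! ### Gaussian binomial coefficients -/

/-- The `q`-Pochhammer symbol `(q;q)_n`. -/
noncomputable def qPoch (n : ℕ) : F2 := ∏ i ∈ range n, (1 - qq ^ (i + 1))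

lemma qPoch_ne_zero (n : ℕ) : qPoch n ≠ 0 :=
  prod_ne_zero_iff.2 fun i _ => one_sub_qq_pow_ne_zero i

lemma qPoch_succ (n : ℕ) : qPoch (n + 1) = qPoch n * (1 - qq ^ (n + 1)) :=
  prod_range_succ _ _

/-- The Gaussian binomial coefficient with natural number arguments. -/
noncomputable def gaussBinom (n k : ℕ) : F2 := qbinomF n k

lemma gaussBinom_add (m k : ℕ) :
    gaussBinom (m + k) k = qPoch (m + k) / (qPoch m * qPoch k) := by
  have h : gaussBinom (m + k) k =
      (∏ i ∈ range k, (1 - qq ^ (m + i + 1))) / qPoch k := by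
    rw [gaussBinom, qbinomF, if_pos (by constructor <;> push_cast <;> omega), Int.toNat_natCast,
      qPoch, ← prod_div_distrib]
    refine prod_congr rfl fun i _ => ?_
    have e : ((m + k : ℕ) : ℤ) - k + i + 1 = ((m + i + 1 : ℕ) : ℤ) := by push_cast; ring
    rw [e, zpow_natCast]
    norm_cast
  have h2 : qPoch (m + k) = qPoch m * ∏ i ∈ range k, (1 - qq ^ (m + i + 1)) :=
    prod_range_add _ _ _
  rw [h, h2, mul_div_mul_left _ _ (qPoch_ne_zero m)]

lemma gaussBinom_zero_right (n : ℕ) : gaussBinom n 0 = 1 := by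
  simp [gaussBinom, qbinomF]

lemma gaussBinom_of_lt {n k : ℕ} (h : n < k) : gaussBinom n k = 0 := by
  rw [gaussBinom, qbinomF, if_neg (by omega), if_neg (by omega)]

lemma gaussBinom_self (n : ℕ) : gaussBinom n n = 1 := by
  have h := gaussBinom_add 0 n
  have h0 : qPoch 0 = 1 := prod_range_zero _
  rwa [zero_add, h0, one_mul, div_self (qPoch_ne_zero n)] at h

lemma gaussBinom_symm (m k : ℕ) : gaussBinom (m + k) k = gaussBinom (m + k) m := by
  rw [gaussBinom_add, add_comm m k, gaussBinom_add, mul_comm]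

lemma gaussBinom_succ_succ (n k : ℕ) :
    gaussBinom (n + 1) (k + 1) = qq ^ (k + 1) * gaussBinom n (k + 1) + gaussBinom n k := by
  rcases lt_trichotomy n k with h | rfl | h
  · simp [gaussBinom_of_lt h, gaussBinom_of_lt (show n < k + 1 by omega),
      gaussBinom_of_lt (show n + 1 < k + 1 by omega)]
  · simp [gaussBinom_self, gaussBinom_of_lt (Nat.lt_succ_self n)]
  · obtain ⟨m, rfl⟩ : ∃ m, n = m + (k + 1) := ⟨n - (k + 1), by omega⟩
    have e₁ := gaussBinom_add (m + 1) (k + 1)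
    have e₂ := gaussBinom_add m (k + 1)
    have e₃ := gaussBinom_add (m + 1) k
    rw [show m + 1 + (k + 1) = m + (k + 1) + 1 by ring, qPoch_succ (m + (k + 1)), qPoch_succ m,
      qPoch_succ k] at e₁
    rw [qPoch_succ k] at e₂
    rw [show m + 1 + k = m + (k + 1) by ring, qPoch_succ m] at e₃
    rw [e₁, e₂, e₃]
    have := qPoch_ne_zero m
    have := qPoch_ne_zero k
    have := one_sub_qq_pow_ne_zero m
    have := one_sub_qq_pow_ne_zero k
    field_simp
    ring

/-! ### Truncated generating sums -/

/-- `∑_{j<M} q^{j(j+k)} [n choose j] [n' choose j+k] t^j`. -/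
noncomputable def gaussBinomSum (M n n' k : ℕ) (t : F2) : F2 :=
  ∑ j ∈ range M, qq ^ (j * (j + k)) * gaussBinom n j * gaussBinom n' (j + k) * t ^ j

lemma gaussBinomSum_eq_of_le {M M' n n' k : ℕ} (hM : M ≤ M') (h : n < M ∨ n' < M + k) (t : F2) :
    gaussBinomSum M n n' k t = gaussBinomSum M' n n' k t := by
  refine sum_subset (range_mono hM) fun j _ hj => ?_
  rw [mem_range, not_lt] at hj
  rcases h with h | h
  · simp [gaussBinom_of_lt (show n < j by omega)]
  · simp [gaussBinom_of_lt (show n' < j + k by omega)]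

lemma gaussBinomSum_succ_right (M n n' k : ℕ) (t : F2) :
    gaussBinomSum M n (n' + 1) (k + 1) t =
      gaussBinomSum M n n' k (qq * t) + qq ^ (k + 1) * gaussBinomSum M n n' (k + 1) (qq * t) := by
  simp only [gaussBinomSum, mul_sum]
  rw [← sum_add_distrib]
  refine sum_congr rfl fun j _ => ?_
  rw [← add_assoc, gaussBinom_succ_succ]
  ring

lemma gaussBinomSum_succ_left (M n n' k : ℕ) (t : F2) :
    gaussBinomSum (M + 1) (n + 1) n' k t =
      gaussBinomSum (M + 1) n n' k (qq * t) +
        qq ^ (k + 1) * t * gaussBinomSum M n n' (k + 1) (qq * t) := by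
  simp only [gaussBinomSum, mul_sum]
  rw [sum_range_succ', sum_range_succ', add_right_comm, ← sum_add_distrib]
  refine congrArg₂ _ ?_ ?_
  · refine sum_congr rfl fun j _ => ?_
    rw [gaussBinom_succ_succ, show j + 1 + k = j + (k + 1) by ring]
    ring
  · simp [gaussBinom_zero_right]

/-! ### The coefficients as generating sums -/

lemma coeffBB_even {M n : ℕ} (k : ℕ) (hM : n < M) (t : F2) :
    coeffBB (2 * n) (2 * k) t = gaussBinomSum M n n k t := by
  rcases le_or_gt k n with h | h
  · rw [coeffBB, if_pos (by omega), if_pos (by omega),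
      ← gaussBinomSum_eq_of_le (M := n - k + 1) (by omega) (by omega) t, gaussBinomSum,
      show (2 * (n : ℤ) / 2 - 2 * (k : ℤ) / 2).toNat = n - k by omega]
    refine sum_congr rfl fun i _ => ?_
    rw [show 2 * (n : ℤ) / 2 = n by omega, show 2 * (k : ℤ) / 2 = k by omega]
    simp only [gaussBinom]
    norm_cast
  · rw [coeffBB, if_neg (by omega), ← gaussBinomSum_eq_of_le (M := 0) (by omega) (by omega) t]
    simp [gaussBinomSum]

lemma coeffBB_odd {M n : ℕ} (k : ℕ) (hM : n + 1 < M) (t : F2) :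
    coeffBB (2 * n + 1) (2 * k + 1) t =
      (1 + t ^ (k + 1))⁻¹ *
        (gaussBinomSum M (n + 1) n k t + t ^ (k + 1) * gaussBinomSum M n (n + 1) (k + 1) t) := by
  rcases le_or_gt k n with h | h
  · obtain ⟨d, rfl⟩ := Nat.exists_eq_add_of_le h
    rw [coeffBB, if_pos (by omega), if_neg (by omega),
      ← gaussBinomSum_eq_of_le (M := d + 1) (by omega) (by omega) t,
      ← gaussBinomSum_eq_of_le (M := d + 1) (n' := k + d + 1) (by omega) (by omega) t,
      show (2 * ((k + d : ℕ) : ℤ) + 1) / 2 = (k + d : ℕ) by omega,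
      show (2 * (k : ℤ) + 1) / 2 = k by omega,
      show (((k + d : ℕ) : ℤ) - (k : ℤ)).toNat = d by omega]
    have hpow : t ^ ((k : ℤ) + 1) = t ^ (k + 1) := by norm_cast
    rw [hpow]
    refine congrArg _ ?_
    simp only [mul_add, sum_add_distrib]
    congr 1
    · refine sum_congr rfl fun i _ => ?_
      rw [add_comm (k : ℤ) (i : ℤ)]
      simp only [gaussBinom]
      norm_cast
      ring
    · rw [gaussBinomSum, mul_sum, ← sum_range_reflect]
      refine sum_congr rfl fun i hi => ?_
      rw [mem_range] at hi
      obtain ⟨e, rfl⟩ := Nat.exists_eq_add_of_le (Nat.lt_succ_iff.1 hi)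
      have s₁ := gaussBinom_symm i (k + e)
      have s₂ := gaussBinom_symm (i + (k + 1)) e
      rw [show i + (k + e) = k + (i + e) by ring] at s₁
      rw [show i + (k + 1) + e = k + (i + e) + 1 by ring] at s₂
      rw [show i + e + 1 - 1 - i = e by omega, ← s₁, ← s₂,
        show ((k + (i + e) : ℕ) : ℤ) + 1 - (e : ℤ) = ((i + (k + 1) : ℕ) : ℤ) by push_cast; ring,
        show ((k + (i + e) : ℕ) : ℤ) - (e : ℤ) - (k : ℤ) = (i : ℤ) by push_cast; ring]
      simp only [gaussBinom]
      norm_cast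
      ring
  · rw [coeffBB, if_neg (by omega), ← gaussBinomSum_eq_of_le (M := 0) (by omega) (by omega) t,
      ← gaussBinomSum_eq_of_le (M := 0) (n' := n + 1) (by omega) (by omega) t]
    simp [gaussBinomSum]

/-! ### The recurrences -/

lemma tauB_even (k : ℕ) (t : F2) : tauB (2 * (k + 1 : ℕ)) t =
    qq ^ (k + 1) * (1 + (qq * t) ^ (k + 1 + 1)) / (1 + (qq * t) ^ (k + 1)) := by
  rw [tauB, if_neg (by omega), if_pos (by omega),
    show 2 * ((k + 1 : ℕ) : ℤ) / 2 = (k + 1 : ℕ) by omega]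
  simp only [mul_pow]
  norm_cast

lemma tauB_odd (k : ℕ) (t : F2) : tauB (2 * k + 1) t =
    qq ^ (k + 1) * t * (1 + t ^ k) / (1 + t ^ (k + 1)) := by
  rw [tauB, if_neg (by omega), if_neg (by omega), show (2 * (k : ℤ) + 1 - 1) / 2 = k by omega]
  norm_cast

lemma coeffBB_even_recurrence_zero (n : ℕ) :
    coeffBB (2 * (n + 1 : ℕ)) 0 tt = tauB 0 tt * coeffBB (2 * n + 1) 1 (qq * tt) := by
  have hA := coeffBB_even (M := n + 3) (n := n + 1) 0 (by omega) tt
  have hB := coeffBB_odd (M := n + 3) (n := n) 0 (by omega) (qq * tt)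
  have hL := gaussBinomSum_succ_left (n + 2) n (n + 1) 0 tt
  rw [gaussBinomSum_eq_of_le (M' := n + 3) (k := 0 + 1) (by omega) (by omega)] at hL
  have hS : gaussBinomSum (n + 3) (n + 1) n 0 (qq * tt) = gaussBinomSum (n + 3) n (n + 1) 0 (qq * tt) :=
    sum_congr rfl fun j _ => by rw [add_zero]; ring
  have h := one_add_qq_mul_tt_pow_ne_zero 0
  simp only [Nat.cast_zero, mul_zero, zero_add, pow_one] at hA hB hL h
  rw [hA, hB, hL, hS, tauB, if_pos rfl, mul_inv_cancel_left₀ h]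

lemma coeffBB_even_recurrence_succ (n k : ℕ) :
    coeffBB (2 * (n + 1 : ℕ)) (2 * (k + 1 : ℕ)) tt =
      coeffBB (2 * n + 1) (2 * k + 1) (qq * tt) +
        tauB (2 * (k + 1 : ℕ)) tt * coeffBB (2 * n + 1) (2 * (k + 1 : ℕ) + 1) (qq * tt) := by
  have hR := gaussBinomSum_succ_right (n + 3) (n + 1) n k tt
  have hL := gaussBinomSum_succ_left (n + 2) n (n + 1) (k + 1) tt
  rw [gaussBinomSum_eq_of_le (M' := n + 3) (k := k + 1 + 1) (by omega) (by omega)] at hL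
  have h₁ := one_add_qq_mul_tt_pow_ne_zero k
  have h₂ := one_add_qq_mul_tt_pow_ne_zero (k + 1)
  rw [coeffBB_odd (M := n + 3) k (by omega), coeffBB_odd (M := n + 3) (k + 1) (by omega),
    coeffBB_even (M := n + 3) _ (by omega), tauB_even]
  rw [div_mul_eq_mul_div, inv_mul_eq_div (1 + (qq * tt) ^ (k + 1)), ← add_div, eq_div_iff h₁,
    mul_assoc (qq ^ (k + 1)), mul_inv_cancel_left₀ h₂]
  linear_combination hR + (qq * tt) ^ (k + 1) * hL

lemma coeffBB_odd_recurrence (n k : ℕ) :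
    coeffBB (2 * n + 1) (2 * k + 1) tt =
      coeffBB (2 * n) (2 * k) (qq * tt) +
        tauB (2 * k + 1) tt * coeffBB (2 * n) (2 * (k + 1 : ℕ)) (qq * tt) := by
  have hL := gaussBinomSum_succ_left (n + 1) n n k tt
  rw [gaussBinomSum_eq_of_le (M' := n + 2) (k := k + 1) (by omega) (by omega)] at hL
  have h := one_add_tt_pow_ne_zero k
  rw [coeffBB_odd (M := n + 2) k (by omega), coeffBB_even (M := n + 2) _ (by omega),
    coeffBB_even (M := n + 2) _ (by omega), tauB_odd, hL, gaussBinomSum_succ_right]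
  field_simp
  ring

/-- The recurrences `b(2n,2k,t,q) = b(2n−1,2k−1,qt,q) + τ_{2k}(t,q) b(2n−1,2k+1,qt,q)` and
`b(2n+1,2k+1,t,q) = b(2n,2k,qt,q) + τ_{2k+1}(t,q) b(2n,2k+2,qt,q)` for `n ≥ 1`, `k ≥ 0`. -/
theorem coeffBB_recurrence (n k : ℤ) (hn : 1 ≤ n) (hk : 0 ≤ k) :
    coeffBB (2 * n) (2 * k) tt =
      coeffBB (2 * n - 1) (2 * k - 1) (qq * tt) +
        tauB (2 * k) tt * coeffBB (2 * n - 1) (2 * k + 1) (qq * tt) ∧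
    coeffBB (2 * n + 1) (2 * k + 1) tt =
      coeffBB (2 * n) (2 * k) (qq * tt) +
        tauB (2 * k + 1) tt * coeffBB (2 * n) (2 * k + 2) (qq * tt) := by
  obtain ⟨n, rfl⟩ : ∃ m : ℕ, n = (m + 1 : ℕ) := ⟨(n - 1).toNat, by omega⟩
  lift k to ℕ using hk
  refine ⟨?_, ?_⟩
  · rw [show 2 * ((n + 1 : ℕ) : ℤ) - 1 = 2 * n + 1 by push_cast; ring]
    cases k with
    | zero =>
      have h : coeffBB (2 * n + 1) (2 * ((0 : ℕ) : ℤ) - 1) (qq * tt) = 0 := by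
        rw [coeffBB, if_neg (by omega)]
      rw [h, zero_add]
      simpa using coeffBB_even_recurrence_zero n
    | succ k =>
      rw [show 2 * ((k + 1 : ℕ) : ℤ) - 1 = 2 * k + 1 by push_cast; ring]
      exact coeffBB_even_recurrence_succ n k
  · rw [show 2 * (k : ℤ) + 2 = 2 * (k + 1 : ℕ) by push_cast; ring]
    exact coeffBB_odd_recurrence (n + 1) k
end
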